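/- arXiv:1303.3327 — 3 statements merged into one kernel-verified Lean document; each statement's English description precedes it below -/
import Mathlib

section
/- Suppose W, Z ⊆ ℕ satisfy W ≰_T Z. Then every 2-bounded coloring f : [ℕ]^2 → ℕ (with no computability hypothesis on f) admits an infinite tail f-rainbow X such that W ≰_T X ⊕ Z. -/
namespace RRT

/-- Partial functions on ℕ that are recursive in the oracle `O`.
This mirrors `Nat.Partrec`, with an extra constructor for the oracle. -/
inductive RecursiveIn (O : ℕ →. ℕ) : (ℕ →. ℕ) → Prop
  | zero : RecursiveIn O (pure 0)
  | succ : RecursiveIn O Nat.succ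
  | left : RecursiveIn O ↑fun n : ℕ => n.unpair.1
  | right : RecursiveIn O ↑fun n : ℕ => n.unpair.2
  | oracle : RecursiveIn O O
  | pair {f g} : RecursiveIn O f → RecursiveIn O g →
      RecursiveIn O fun n => Nat.pair <$> f n <*> g n
  | comp {f g} : RecursiveIn O f → RecursiveIn O g →
      RecursiveIn O fun n => g n >>= f
  | prec {f g} : RecursiveIn O f → RecursiveIn O g →
      RecursiveIn O (Nat.unpaired fun a n =>
        n.rec (f a) fun y IH => do let i ← IH; g (Nat.pair a (Nat.pair y i)))
  | rfind {f} : RecursiveIn O f →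
      RecursiveIn O fun a => Nat.rfind fun n => (fun m => m = 0) <$> f (Nat.pair a n)

/-- The characteristic function of a set of naturals. -/
noncomputable def chi (A : Set ℕ) : ℕ → ℕ := A.indicator fun _ => 1

/-- Turing reducibility `A ≤_T B` for sets of naturals: the characteristic function of `A`
is computable relative to an oracle for the characteristic function of `B`. -/
def TuringLE (A B : Set ℕ) : Prop := RecursiveIn (chi B) (chi A)

/-- The recursive join `A ⊕ B = {2n : n ∈ A} ∪ {2n+1 : n ∈ B}`. -/
def join (A B : Set ℕ) : Set ℕ :=
  {n : ℕ | (∃ m ∈ A, n = 2 * m) ∨ (∃ m ∈ B, n = 2 * m + 1)}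

/-- A total function `f : ℕ → ℕ` is computable relative to an oracle for `Z ⊆ ℕ`. -/
def FunRecIn (Z : Set ℕ) (f : ℕ → ℕ) : Prop := RecursiveIn (chi Z) f


/-- A coloring of `[ℕ]²` (identified with pairs `(x,y)`, `x < y`) is 2-bounded if
every color has at most 2 preimages. -/
def Bounded2Pairs (f : ℕ → ℕ → ℕ) : Prop :=
  ∀ c : ℕ, {p : ℕ × ℕ | p.1 < p.2 ∧ f p.1 p.2 = c}.encard ≤ 2

/-- `X` is an `f`-rainbow: `f` is injective on `[X]²`. -/
def RainbowOn (f : ℕ → ℕ → ℕ) (X : Set ℕ) : Prop :=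
  ∀ x₀ x₁ y₀ y₁ : ℕ, x₀ ∈ X → x₁ ∈ X → y₀ ∈ X → y₁ ∈ X →
    x₀ < x₁ → y₀ < y₁ → f x₀ x₁ = f y₀ y₁ → x₀ = y₀ ∧ x₁ = y₁

/-- `X` is a tail `f`-rainbow: pairs from `X` with distinct second coordinates get
distinct colors. -/
def TailRainbowOn (f : ℕ → ℕ → ℕ) (X : Set ℕ) : Prop :=
  ∀ x₀ x₁ y₀ y₁ : ℕ, x₀ ∈ X → x₁ ∈ X → y₀ ∈ X → y₁ ∈ X →
    x₀ < x₁ → y₀ < y₁ → x₁ ≠ y₁ → f x₀ x₁ ≠ f y₀ y₁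


/-- prefix of length `s` of an oracle -/
def pre (O : ℕ → ℕ) (s : ℕ) : List ℕ := (List.range s).map O

theorem pre_isPre (O : ℕ → ℕ) {s t : ℕ} (h : s ≤ t) : pre O s <+: pre O t := by
  unfold pre
  apply List.IsPrefix.map
  obtain ⟨k, rfl⟩ := Nat.exists_eq_add_of_le h
  rw [List.range_add]
  exact List.prefix_append _ _

/-- monotone primitive recursive finite approximations of functionals -/
structure IsFun (F : List ℕ → ℕ → Option ℕ) : Prop where
  prim : Primrec₂ F
  mono : ∀ l l' n v, l <+: l' → F l n = some v → F l' n = some v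

theorem IsFun.pre_mono {F} (hF : IsFun F) (O : ℕ → ℕ) {s t n v : ℕ} (h : s ≤ t)
    (h1 : F (pre O s) n = some v) : F (pre O t) n = some v :=
  hF.mono _ _ _ _ (pre_isPre O h) h1

theorem IsFun.uniq {F} (hF : IsFun F) (O : ℕ → ℕ) {s t n v w : ℕ}
    (h1 : F (pre O s) n = some v) (h2 : F (pre O t) n = some w) : v = w := by
  have a := hF.pre_mono O (le_max_left s t) h1
  have b := hF.pre_mono O (le_max_right s t) h2
  rw [a] at b
  exact Option.some.inj b

/-- `F` represents `f` with oracle `O`. -/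
def Reps (O : ℕ → ℕ) (F : List ℕ → ℕ → Option ℕ) (f : ℕ →. ℕ) : Prop :=
  ∀ n v, v ∈ f n ↔ ∃ s, F (pre O s) n = some v

theorem isFun_total {g : ℕ → ℕ} (hg : Primrec g) : IsFun (fun _ n => some (g n)) :=
  ⟨Primrec.option_some.comp (hg.comp Primrec.snd), fun _ _ _ _ _ h => h⟩

theorem reps_total (O : ℕ → ℕ) (g : ℕ → ℕ) : Reps O (fun _ n => some (g n)) (g : ℕ →. ℕ) := by
  intro n v
  simp [eq_comm]

theorem use_oracle (O : ℕ → ℕ) : ∃ F, IsFun F ∧ Reps O F (O : ℕ →. ℕ) := by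
  refine ⟨fun l n => l[n]?, ⟨Primrec.list_getElem?, ?_⟩, ?_⟩
  · rintro l l' n v ⟨t, rfl⟩ h
    obtain ⟨hn, h⟩ := List.getElem?_eq_some_iff.1 h
    rw [List.getElem?_append_left hn]
    exact List.getElem?_eq_some_iff.2 ⟨hn, h⟩
  · intro n v
    simp only [PFun.coe_val, Part.mem_some_iff, pre]
    constructor
    · rintro rfl
      exact ⟨n + 1, by simp⟩
    · rintro ⟨s, h⟩
      simp only [List.getElem?_map, Option.map_eq_some_iff] at h
      obtain ⟨a, h1, h2⟩ := h
      obtain ⟨h3, h4⟩ := List.getElem?_eq_some_iff.1 h1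
      simp at h4
      subst h4; exact h2.symm

theorem use_pair {O : ℕ → ℕ} {f g : ℕ →. ℕ} (hf : ∃ F, IsFun F ∧ Reps O F f)
    (hg : ∃ F, IsFun F ∧ Reps O F g) :
    ∃ F, IsFun F ∧ Reps O F (fun n => Nat.pair <$> f n <*> g n) := by
  obtain ⟨F, hF, rF⟩ := hf
  obtain ⟨G, hG, rG⟩ := hg
  refine ⟨fun l n => (F l n).bind fun a => (G l n).map fun b => Nat.pair a b, ⟨?_, ?_⟩, ?_⟩
  · refine Primrec.option_bind hF.prim ?_
    refine Primrec.option_map (hG.prim.comp (Primrec.fst.comp Primrec.fst)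
      (Primrec.snd.comp Primrec.fst)) ?_
    exact Primrec₂.natPair.comp (Primrec.snd.comp Primrec.fst) Primrec.snd
  · intro l l' n v h h1
    simp only [Option.bind_eq_some_iff, Option.map_eq_some_iff] at h1 ⊢
    obtain ⟨a, ha, b, hb, e⟩ := h1
    exact ⟨a, hF.mono _ _ _ _ h ha, b, hG.mono _ _ _ _ h hb, e⟩
  · intro n v
    simp only [Seq.seq, Part.map_eq_map, Part.mem_bind_iff, Part.mem_map_iff,
      Option.bind_eq_some_iff, Option.map_eq_some_iff]
    constructor
    · rintro ⟨_, ⟨a, ha, rfl⟩, b, hb, rfl⟩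
      obtain ⟨s, hs⟩ := (rF _ _).1 ha
      obtain ⟨t, ht⟩ := (rG _ _).1 hb
      exact ⟨max s t, a, hF.pre_mono O (le_max_left _ _) hs, b,
        hG.pre_mono O (le_max_right _ _) ht, rfl⟩
    · rintro ⟨s, a, ha, b, hb, rfl⟩
      exact ⟨_, ⟨a, (rF _ _).2 ⟨s, ha⟩, rfl⟩, b, (rG _ _).2 ⟨s, hb⟩, rfl⟩

theorem use_comp {O : ℕ → ℕ} {f g : ℕ →. ℕ} (hf : ∃ F, IsFun F ∧ Reps O F f)
    (hg : ∃ F, IsFun F ∧ Reps O F g) :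
    ∃ F, IsFun F ∧ Reps O F (fun n => g n >>= f) := by
  obtain ⟨F, hF, rF⟩ := hf
  obtain ⟨G, hG, rG⟩ := hg
  refine ⟨fun l n => (G l n).bind fun a => F l a, ⟨?_, ?_⟩, ?_⟩
  · exact Primrec.option_bind hG.prim
      (hF.prim.comp (Primrec.fst.comp Primrec.fst) Primrec.snd)
  · intro l l' n v h h1
    simp only [Option.bind_eq_some_iff] at h1 ⊢
    obtain ⟨a, ha, b⟩ := h1
    exact ⟨a, hG.mono _ _ _ _ h ha, hF.mono _ _ _ _ h b⟩
  · intro n v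
    refine (Part.mem_bind_iff (f := g n) (g := f)).trans ?_
    simp only [Option.bind_eq_some_iff]
    constructor
    · rintro ⟨a, ha, hb⟩
      obtain ⟨s, hs⟩ := (rG _ _).1 ha
      obtain ⟨t, ht⟩ := (rF _ _).1 hb
      exact ⟨max s t, a, hG.pre_mono O (le_max_left _ _) hs,
        hF.pre_mono O (le_max_right _ _) ht⟩
    · rintro ⟨s, a, ha, hb⟩
      exact ⟨a, (rG _ _).2 ⟨s, ha⟩, (rF _ _).2 ⟨s, hb⟩⟩

theorem use_prec {O : ℕ → ℕ} {f g : ℕ →. ℕ} (hf : ∃ F, IsFun F ∧ Reps O F f)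
    (hg : ∃ F, IsFun F ∧ Reps O F g) :
    ∃ F, IsFun F ∧ Reps O F (Nat.unpaired fun a n =>
        n.rec (f a) fun y IH => do let i ← IH; g (Nat.pair a (Nat.pair y i))) := by
  obtain ⟨F, hF, rF⟩ := hf
  obtain ⟨G, hG, rG⟩ := hg
  refine ⟨fun l p => Nat.rec (motive := fun _ => Option ℕ) (F l p.unpair.1)
    (fun y IH => IH.bind fun i => G l (Nat.pair p.unpair.1 (Nat.pair y i))) p.unpair.2,
    ⟨?_, ?_⟩, ?_⟩
  · have h1 : Primrec (fun q : List ℕ × ℕ => q.2.unpair.1) :=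
      Primrec.fst.comp (Primrec.unpair.comp Primrec.snd)
    have h2 : Primrec (fun q : List ℕ × ℕ => q.2.unpair.2) :=
      Primrec.snd.comp (Primrec.unpair.comp Primrec.snd)
    have h3 : Primrec₂ (fun (q : List ℕ × ℕ) (r : ℕ × Option ℕ) => r.2.bind fun i =>
        G q.1 (Nat.pair q.2.unpair.1 (Nat.pair r.1 i))) := ?_
    · exact Primrec.nat_rec' h2 (hF.prim.comp Primrec.fst h1) h3
    refine Primrec.option_bind (Primrec.snd.comp Primrec.snd) ?_
    refine hG.prim.comp (Primrec.fst.comp (Primrec.fst.comp Primrec.fst)) ?_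
    refine Primrec₂.natPair.comp (h1.comp (Primrec.fst.comp Primrec.fst)) ?_
    exact Primrec₂.natPair.comp (Primrec.fst.comp (Primrec.snd.comp Primrec.fst)) Primrec.snd
  · intro l l' n v h
    generalize n.unpair.1 = a
    generalize n.unpair.2 = m
    induction m generalizing v with
    | zero => exact hF.mono _ _ _ _ h
    | succ m ih =>
      simp only [Option.bind_eq_some_iff]
      rintro ⟨i, hi, h2⟩
      exact ⟨i, ih _ hi, hG.mono _ _ _ _ h h2⟩
  · intro n v
    dsimp only [Nat.unpaired]
    generalize n.unpair.1 = a
    generalize n.unpair.2 = m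
    have mono : ∀ m v s t, s ≤ t →
      Nat.rec (motive := fun _ => Option ℕ) (F (pre O s) a)
        (fun y IH => IH.bind fun i => G (pre O s) (Nat.pair a (Nat.pair y i))) m = some v →
      Nat.rec (motive := fun _ => Option ℕ) (F (pre O t) a)
        (fun y IH => IH.bind fun i => G (pre O t) (Nat.pair a (Nat.pair y i))) m = some v := by
      intro m v s t hst
      induction m generalizing v with
      | zero => exact hF.pre_mono O hst
      | succ m ih =>
        simp only [Option.bind_eq_some_iff]
        rintro ⟨i, hi, h2⟩
        exact ⟨i, ih _ hi, hG.pre_mono O hst h2⟩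
    induction m generalizing v with
    | zero => exact rF _ _
    | succ m ih =>
      simp only [Part.bind_eq_bind, Part.mem_bind_iff, Option.bind_eq_some_iff]
      constructor
      · rintro ⟨i, hi, h2⟩
        obtain ⟨s, hs⟩ := (ih _).1 hi
        obtain ⟨t, ht⟩ := (rG _ _).1 h2
        exact ⟨max s t, i, mono _ _ _ _ (le_max_left _ _) hs,
          hG.pre_mono O (le_max_right _ _) ht⟩
      · rintro ⟨s, i, hi, h2⟩
        exact ⟨i, (ih _).2 ⟨s, hi⟩, (rG _ _).2 ⟨s, h2⟩⟩

/-- bounded search with a finite oracle -/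
def fsearch (F : List ℕ → ℕ → Option ℕ) (l : List ℕ) (a : ℕ) : ℕ :=
  (List.range l.length).findIdx fun m =>
    decide (F l (Nat.pair a m) = none ∨ F l (Nat.pair a m) = some 0)

theorem fsearch_spec (F : List ℕ → ℕ → Option ℕ) (l : List ℕ) (a m : ℕ) :
    (if F l (Nat.pair a (fsearch F l a)) = some 0 then some (fsearch F l a) else none) = some m ↔
    m ≤ l.length ∧ F l (Nat.pair a m) = some 0 ∧
      ∀ j < m, ∃ v, v ≠ 0 ∧ F l (Nat.pair a j) = some v := by
  have hlt : ∀ j < fsearch F l a, ∃ v, v ≠ 0 ∧ F l (Nat.pair a j) = some v := by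
    intro j hj
    have := List.not_of_lt_findIdx hj
    rw [List.getElem_range] at this
    have := of_decide_eq_false this
    obtain ⟨h1, h2⟩ := not_or.1 this
    obtain ⟨v, hv⟩ := Option.ne_none_iff_exists'.1 h1
    exact ⟨v, fun h => h2 (h ▸ hv), hv⟩
  have hle : fsearch F l a ≤ l.length := by
    have := List.findIdx_le_length (xs := List.range l.length) (p := fun m =>
      decide (F l (Nat.pair a m) = none ∨ F l (Nat.pair a m) = some 0))
    simpa [fsearch] using this
  constructor
  · intro h
    split_ifs at h with h0
    cases h
    exact ⟨hle, h0, hlt⟩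
  · rintro ⟨h1, h2, h3⟩
    have : fsearch F l a = m := by
      apply le_antisymm
      · by_contra! hc
        obtain ⟨v, hv, e⟩ := hlt m hc
        rw [h2] at e; exact hv (Option.some.inj e).symm
      · by_contra! hc
        have hlen : fsearch F l a < (List.range l.length).length := by simp; omega
        have := List.findIdx_getElem (w := hlen)
        have := of_decide_eq_true this
        have e0 := List.getElem_range hlen
        unfold fsearch at e0
        rw [e0] at this
        obtain ⟨v, hv, e⟩ := h3 _ hc
        change F l (Nat.pair a (fsearch F l a)) = none ∨
          F l (Nat.pair a (fsearch F l a)) = some 0 at this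
        rw [e] at this
        simp at this
        exact hv this
    rw [this, if_pos h2]

theorem use_rfind {O : ℕ → ℕ} {f : ℕ →. ℕ} (hf : ∃ F, IsFun F ∧ Reps O F f) :
    ∃ F, IsFun F ∧ Reps O F
      (fun a => Nat.rfind fun n => (fun m => decide (m = 0)) <$> f (Nat.pair a n)) := by
  obtain ⟨F, hF, rF⟩ := hf
  refine ⟨fun l a => if F l (Nat.pair a (fsearch F l a)) = some 0 then some (fsearch F l a)
    else none, ⟨?_, ?_⟩, ?_⟩
  · have h1 : Primrec (fun q : List ℕ × ℕ => fsearch F q.1 q.2) := by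
      refine Primrec.list_findIdx (Primrec.list_range.comp (Primrec.list_length.comp Primrec.fst)) ?_
      have h2 : Primrec (fun q : (List ℕ × ℕ) × ℕ => F q.1.1 (Nat.pair q.1.2 q.2)) :=
        hF.prim.comp (Primrec.fst.comp Primrec.fst)
          (Primrec₂.natPair.comp (Primrec.snd.comp Primrec.fst) Primrec.snd)
      have h3 : PrimrecPred (fun q : (List ℕ × ℕ) × ℕ => F q.1.1 (Nat.pair q.1.2 q.2) = none ∨
          F q.1.1 (Nat.pair q.1.2 q.2) = some 0) :=
        (Primrec.eq.comp h2 (Primrec.const none)).or (Primrec.eq.comp h2 (Primrec.const (some 0)))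
      exact h3.decide
    refine Primrec.ite (Primrec.eq.comp ?_ (Primrec.const (some 0))) (Primrec.option_some.comp h1)
      (Primrec.const none)
    exact hF.prim.comp Primrec.fst (Primrec₂.natPair.comp Primrec.snd h1)
  · intro l l' n v h
    rw [fsearch_spec, fsearch_spec]
    rintro ⟨h1, h2, h3⟩
    refine ⟨h1.trans h.length_le, hF.mono _ _ _ _ h h2, fun j hj => ?_⟩
    obtain ⟨v, hv, e⟩ := h3 j hj
    exact ⟨v, hv, hF.mono _ _ _ _ h e⟩
  · intro a m
    simp only [fsearch_spec]
    change m ∈ Nat.rfind (fun n => Part.map (fun m => decide (m = 0)) (f (Nat.pair a n))) ↔ _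
    refine Nat.mem_rfind.trans ?_
    simp only [Part.mem_map_iff, decide_eq_true_eq, decide_eq_false_iff_not]
    constructor
    · rintro ⟨⟨v, hv, rfl⟩, h2⟩
      obtain ⟨s, hs⟩ := (rF _ _).1 hv
      have : ∀ j, ∃ t, j < m → ∃ v, v ≠ 0 ∧ F (pre O t) (Nat.pair a j) = some v := by
        intro j
        by_cases hj : j < m
        · obtain ⟨w, hw, hw0⟩ := h2 hj
          obtain ⟨t, ht⟩ := (rF _ _).1 hw
          exact ⟨t, fun _ => ⟨w, hw0, ht⟩⟩
        · exact ⟨0, fun h => absurd h hj⟩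
      choose t ht using this
      let T := max (max s m) ((Finset.range m).sup t)
      refine ⟨T, ?_, hF.pre_mono O (le_trans (le_max_left _ _) (le_max_left _ _)) hs, ?_⟩
      · simp only [pre, List.length_map, List.length_range]
        exact le_trans (le_max_right _ _) (le_max_left _ _)
      · intro j hj
        obtain ⟨w, hw, e⟩ := ht j hj
        refine ⟨w, hw, hF.pre_mono O (le_trans ?_ (le_max_right _ _)) e⟩
        exact Finset.le_sup (f := t) (Finset.mem_range.2 hj)
    · rintro ⟨s, h1, h2, h3⟩
      refine ⟨⟨0, (rF _ _).2 ⟨s, h2⟩, rfl⟩, fun {j} hj => ?_⟩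
      obtain ⟨v, hv, e⟩ := h3 j hj
      exact ⟨v, (rF _ _).2 ⟨s, e⟩, hv⟩

theorem use_principle {O : ℕ → ℕ} {f : ℕ →. ℕ} (h : RecursiveIn (O : ℕ →. ℕ) f) :
    ∃ F, IsFun F ∧ Reps O F f := by
  induction h with
  | zero => exact ⟨_, isFun_total (Primrec.const 0), reps_total O _⟩
  | succ => exact ⟨_, isFun_total Primrec.succ, reps_total O _⟩
  | left => exact ⟨_, isFun_total (Primrec.fst.comp Primrec.unpair), reps_total O _⟩
  | right => exact ⟨_, isFun_total (Primrec.snd.comp Primrec.unpair), reps_total O _⟩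
  | oracle => exact use_oracle O
  | pair _ _ h1 h2 => exact use_pair h1 h2
  | comp _ _ h1 h2 => exact use_comp h1 h2
  | prec _ _ h1 h2 => exact use_prec h1 h2
  | rfind _ h1 => exact use_rfind h1

theorem countable_isFun : {F | IsFun F}.Countable := by
  have h0 : ∀ F, IsFun F → ∃ c : Nat.Partrec.Code, ∀ l n,
      c.eval (Encodable.encode ((l, n) : List ℕ × ℕ)) = Part.some (Encodable.encode (F l n)) := by
    intro F hF
    have h1 : Nat.Partrec _ := (hF.prim.to_comp : Computable (fun p : List ℕ × ℕ => F p.1 p.2))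
    obtain ⟨c, hc⟩ := Nat.Partrec.Code.exists_code.1 h1
    refine ⟨c, fun l n => ?_⟩
    rw [hc]
    simp
  choose! c hc using h0
  refine Set.MapsTo.countable_of_injOn (f := c) (t := Set.univ) (fun _ _ => trivial) ?_ (Set.to_countable _)
  intro F hF G hG e
  funext l n
  have a := hc F hF l n
  rw [e, hc G hG l n] at a
  exact (Encodable.encode_injective (Part.some_injective a)).symm

theorem RecursiveIn.congr' {O f g : ℕ →. ℕ} (h : RecursiveIn O f) (e : ∀ n, g n = f n) :
    RecursiveIn O g := by
  have : g = f := funext e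
  rwa [this]

theorem rec_total_comp {O : ℕ →. ℕ} {f g : ℕ → ℕ} (hf : RecursiveIn O (f : ℕ →. ℕ))
    (hg : RecursiveIn O (g : ℕ →. ℕ)) : RecursiveIn O ((fun n => f (g n) : ℕ → ℕ) : ℕ →. ℕ) := by
  have := RecursiveIn.comp hf hg
  refine RecursiveIn.congr' this fun n => ?_
  exact (Part.bind_some (g n) (f : ℕ →. ℕ)).symm

theorem rec_total_pair {O : ℕ →. ℕ} {f g : ℕ → ℕ} (hf : RecursiveIn O (f : ℕ →. ℕ))
    (hg : RecursiveIn O (g : ℕ →. ℕ)) :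
    RecursiveIn O ((fun n => Nat.pair (f n) (g n) : ℕ → ℕ) : ℕ →. ℕ) := by
  have := RecursiveIn.pair hf hg
  refine RecursiveIn.congr' this fun n => ?_
  simp [Seq.seq]

theorem rec_of_primrec {O : ℕ →. ℕ} {g : ℕ → ℕ} (h : Nat.Primrec g) :
    RecursiveIn O (g : ℕ →. ℕ) := by
  induction h with
  | zero => exact RecursiveIn.zero
  | succ => exact RecursiveIn.succ
  | left => exact RecursiveIn.left
  | right => exact RecursiveIn.right
  | pair _ _ h1 h2 => exact rec_total_pair h1 h2
  | comp _ _ h1 h2 => exact rec_total_comp h1 h2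
  | prec _ _ h1 h2 =>
    have := RecursiveIn.prec h1 h2
    refine RecursiveIn.congr' this fun n => ?_
    simp only [Nat.unpaired, PFun.coe_val]
    generalize n.unpair.1 = a
    generalize n.unpair.2 = m
    induction m with
    | zero => rfl
    | succ m ih => simp only [← ih]; simp

theorem rec_pre (O : ℕ → ℕ) : RecursiveIn (O : ℕ →. ℕ)
    ((fun n => Encodable.encode (pre O n) : ℕ → ℕ) : ℕ →. ℕ) := by
  let app : ℕ → ℕ := fun p => Encodable.encode
    (((Encodable.decode (α := List ℕ) p.unpair.1).getD []) ++ [p.unpair.2])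
  have happ : Nat.Primrec app := by
    apply Primrec.nat_iff.1
    refine Primrec.encode.comp (Primrec.list_append.comp (Primrec.option_getD.comp
      (Primrec.decode.comp (Primrec.fst.comp Primrec.unpair)) (Primrec.const []))
      (Primrec.list_cons.comp (Primrec.snd.comp Primrec.unpair) (Primrec.const [])))
  have hy : Nat.Primrec (fun n : ℕ => n.unpair.2.unpair.1) :=
    Nat.Primrec.left.comp Nat.Primrec.right
  have hi : Nat.Primrec (fun n : ℕ => n.unpair.2.unpair.2) :=
    Nat.Primrec.right.comp Nat.Primrec.right
  have hstep : RecursiveIn (O : ℕ →. ℕ) ((fun n => app (Nat.pair n.unpair.2.unpair.2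
      (O n.unpair.2.unpair.1)) : ℕ → ℕ) : ℕ →. ℕ) :=
    rec_total_comp (rec_of_primrec happ) (rec_total_pair (rec_of_primrec hi)
      (rec_total_comp RecursiveIn.oracle (rec_of_primrec hy)))
  have hz : RecursiveIn (O : ℕ →. ℕ) ((fun _ => Encodable.encode ([] : List ℕ) : ℕ → ℕ) : ℕ →. ℕ) :=
    rec_of_primrec (Nat.Primrec.const _)
  have h1 := RecursiveIn.prec hz hstep
  have h2 := RecursiveIn.comp h1 (rec_of_primrec (O := (O : ℕ →. ℕ))
    ((Nat.Primrec.const 0).pair Nat.Primrec.id))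
  refine RecursiveIn.congr' h2 fun n => ?_
  simp only [PFun.coe_val, Nat.unpaired, Part.bind_eq_bind, Part.bind_some, Nat.unpair_pair]
  simp only [id]
  induction n with
  | zero => rfl
  | succ n ih =>
    simp only [← ih, Part.bind_some]
    congr 1
    simp [app, pre, List.range_succ]

theorem rec_search (O : ℕ → ℕ) (H : ℕ → ℕ → List ℕ → Bool)
    (hH : Primrec (fun p : ℕ × ℕ × List ℕ => H p.1 p.2.1 p.2.2)) (g : ℕ → ℕ)
    (h1 : ∀ n, ∃ m, H n m (pre O m) = true)
    (h2 : ∀ n m, H n m (pre O m) = true → m.unpair.2 = g n) :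
    RecursiveIn (O : ℕ →. ℕ) (g : ℕ →. ℕ) := by
  let t : ℕ → ℕ := fun p => bif H p.unpair.1 p.unpair.2.unpair.1
    ((Encodable.decode (α := List ℕ) p.unpair.2.unpair.2).getD []) then 0 else 1
  have ht : Nat.Primrec t := by
    apply Primrec.nat_iff.1
    have a1 : Primrec (fun p : ℕ => p.unpair.1) := Primrec.fst.comp Primrec.unpair
    have a2 : Primrec (fun p : ℕ => p.unpair.2) := Primrec.snd.comp Primrec.unpair
    refine Primrec.cond ?_ (Primrec.const 0) (Primrec.const 1)
    exact hH.comp (a1.pair ((a1.comp a2).pair (Primrec.option_getD.comp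
      (Primrec.decode.comp (a2.comp a2)) (Primrec.const []))))
  have r1 : RecursiveIn (O : ℕ →. ℕ) ((fun p => t (Nat.pair p.unpair.1 (Nat.pair p.unpair.2
      (Encodable.encode (pre O p.unpair.2)))) : ℕ → ℕ) : ℕ →. ℕ) :=
    rec_total_comp (rec_of_primrec ht) (rec_total_pair RecursiveIn.left
      (rec_total_pair RecursiveIn.right (rec_total_comp (rec_pre O) RecursiveIn.right)))
  have r2 := RecursiveIn.comp RecursiveIn.right (RecursiveIn.rfind r1)
  refine RecursiveIn.congr' r2 fun n => ?_
  symm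
  apply Part.eq_some_iff.2
  refine Part.mem_bind_iff.2 ?_
  simp only [PFun.coe_val, Part.mem_some_iff]
  have hex := h1 n
  classical
  refine ⟨Nat.find hex, ?_, (h2 _ _ (Nat.find_spec hex)).symm⟩
  refine Nat.mem_rfind.2 ?_
  have key : ∀ m, t (Nat.pair n (Nat.pair m (Encodable.encode (pre O m)))) = 0 ↔
      H n m (pre O m) = true := by
    intro m
    simp only [t, Nat.unpair_pair, Encodable.encodek, Option.getD_some]
    cases H n m (pre O m) <;> simp
  simp only [Part.map_eq_map, Part.map_some, Part.mem_some_iff, Nat.unpair_pair]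
  constructor
  · exact (decide_eq_true ((key _).2 (Nat.find_spec hex))).symm
  · intro m hm
    exact (decide_eq_false (fun h => Nat.find_min hex hm ((key _).1 h))).symm

/-! ### The probability space -/

open MeasureTheory ProbabilityTheory

/-- the sample space: one choice inside each block -/
abbrev Om : Type := (n : ℕ) → Fin (4 * 8 ^ n)

instance instNeZeroBlock (n : ℕ) : NeZero (4 * 8 ^ n) := ⟨by positivity⟩

/-- uniform measure on a block -/
noncomputable def nu (n : ℕ) : Measure (Fin (4 * 8 ^ n)) := uniformOn Set.univ

instance instProbNu (n : ℕ) : IsProbabilityMeasure (nu n) := by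
  unfold nu
  exact isProbabilityMeasure_uniformOn Set.finite_univ Set.univ_nonempty

/-- product measure -/
noncomputable def mu : Measure Om := Measure.infinitePi nu

instance instProbMu : IsProbabilityMeasure mu := by
  unfold mu
  infer_instance

/-- the increasing sequence of naturals associated with a sample -/
def xs (w : Om) (n : ℕ) : ℕ := 4 * 8 ^ n + (w n : ℕ)

theorem xs_lt (w : Om) (n : ℕ) : xs w n < 8 * 8 ^ n := by
  have := (w n).2
  unfold xs
  omega

theorem xs_strictMono (w : Om) : StrictMono (xs w) := by
  apply strictMono_nat_of_lt_succ
  intro n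
  have h1 := xs_lt w n
  have : 4 * 8 ^ (n + 1) ≤ xs w (n + 1) := Nat.le_add_right _ _
  have h2 : 8 ^ (n + 1) = 8 * 8 ^ n := by ring
  omega

/-- all initial segments of length `s` -/
def Ls (s : ℕ) : List (List ℕ) :=
  Nat.rec [[]] (fun s L => L.flatMap fun l => (List.range (4 * 8 ^ s)).map fun j =>
    l ++ [4 * 8 ^ s + j]) s

theorem Ls_succ (s : ℕ) : Ls (s + 1) = (Ls s).flatMap fun l =>
    (List.range (4 * 8 ^ s)).map fun j => l ++ [4 * 8 ^ s + j] := rfl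

theorem Ls_length_succ (s : ℕ) : (Ls (s + 1)).length = (Ls s).length * (4 * 8 ^ s) := by
  rw [Ls_succ, List.length_flatMap]
  simp

theorem Ls_length (s : ℕ) : (Ls s).length = ∏ i ∈ Finset.range s, 4 * 8 ^ i := by
  induction s with
  | zero => rfl
  | succ s ih => rw [Ls_length_succ, ih, Finset.prod_range_succ]

theorem Ls_length_pos (s : ℕ) : 0 < (Ls s).length := by
  rw [Ls_length]
  positivity

theorem pre_succ (O : ℕ → ℕ) (s : ℕ) : pre O (s + 1) = pre O s ++ [O s] := by
  simp [pre, List.range_succ]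

theorem pre_mem_Ls (w : Om) (s : ℕ) : pre (xs w) s ∈ Ls s := by
  induction s with
  | zero => simp [pre, Ls]
  | succ s ih =>
    rw [pre_succ, Ls_succ, List.mem_flatMap]
    refine ⟨_, ih, List.mem_map.2 ⟨w s, ?_, rfl⟩⟩
    exact List.mem_range.2 (w s).2

theorem pre_congr {O O' : ℕ → ℕ} {s : ℕ} (h : ∀ i < s, O i = O' i) : pre O s = pre O' s := by
  unfold pre
  apply List.map_congr_left
  intro i hi
  exact h i (List.mem_range.1 hi)

theorem exists_of_mem_Ls {s : ℕ} {l : List ℕ} (h : l ∈ Ls s) : ∃ w : Om, l = pre (xs w) s := by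
  induction s generalizing l with
  | zero =>
    refine ⟨fun _ => 0, ?_⟩
    simpa [pre, Ls] using h
  | succ s ih =>
    rw [Ls_succ, List.mem_flatMap] at h
    obtain ⟨l', h1, h2⟩ := h
    obtain ⟨j, hj, rfl⟩ := List.mem_map.1 h2
    obtain ⟨w, rfl⟩ := ih h1
    refine ⟨Function.update w s ⟨j, List.mem_range.1 hj⟩, ?_⟩
    rw [pre_succ]
    congr 1
    · apply pre_congr
      intro i hi
      simp [xs, Function.update_of_ne hi.ne]
    · simp [xs]

theorem Ls_nodup (s : ℕ) : (Ls s).Nodup := by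
  induction s with
  | zero => simp [Ls]
  | succ s ih =>
    rw [Ls_succ, List.nodup_flatMap]
    constructor
    · intro l _
      refine List.Nodup.map ?_ List.nodup_range
      intro a b h
      simpa using h
    · refine List.Pairwise.imp ?_ ih
      intro a b hab
      simp only [Function.onFun]
      intro x hx hy
      obtain ⟨i, _, rfl⟩ := List.mem_map.1 hx
      obtain ⟨j, _, e⟩ := List.mem_map.1 hy
      exact hab (List.append_inj_left' e rfl).symm

theorem cyl_eq (w : Om) (s : ℕ) : {w' : Om | pre (xs w') s = pre (xs w) s} =
    Set.pi (Finset.range s : Set ℕ) (fun i => ({w i} : Set (Fin (4 * 8 ^ i)))) := by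
  ext w'
  simp only [pre, List.map_inj_left, List.mem_range, xs, Set.mem_ofPred_eq, Set.mem_pi,
    Finset.coe_range, Set.mem_Iio, Set.mem_singleton_iff, Nat.add_left_cancel_iff, Fin.ext_iff]

theorem cyl_meas (w : Om) (s : ℕ) : MeasurableSet {w' : Om | pre (xs w') s = pre (xs w) s} := by
  rw [cyl_eq]
  exact MeasurableSet.pi (Finset.range s).countable_toSet fun i _ => measurableSet_singleton _

theorem nu_singleton (i : ℕ) (a : Fin (4 * 8 ^ i)) : nu i {a} = ((4 * 8 ^ i : ℕ) : ENNReal)⁻¹ := by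
  unfold nu
  rw [uniformOn_univ]
  simp

theorem cyl_mu (w : Om) (s : ℕ) : mu {w' : Om | pre (xs w') s = pre (xs w) s} =
    ((Ls s).length : ENNReal)⁻¹ := by
  rw [cyl_eq, mu, Measure.infinitePi_pi _ (fun i _ => measurableSet_singleton _)]
  simp only [nu_singleton]
  rw [Ls_length, Nat.cast_prod, ENNReal.prod_inv_distrib]
  intro i _ j _ _
  right
  exact ENNReal.natCast_ne_top _

theorem clopen_eq (p : List ℕ → Prop) [DecidablePred p] (s : ℕ) : {w : Om | p (pre (xs w) s)} =
    ⋃ l ∈ ((Ls s).filter p).toFinset, {w : Om | pre (xs w) s = l} := by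
  ext w
  simp only [Set.mem_ofPred_eq, Set.mem_iUnion, exists_prop, List.mem_toFinset, List.mem_filter,
    decide_eq_true_eq]
  constructor
  · exact fun h => ⟨_, ⟨pre_mem_Ls w s, h⟩, rfl⟩
  · rintro ⟨l, ⟨_, h⟩, rfl⟩
    exact h

theorem clopen_meas (p : List ℕ → Prop) (s : ℕ) : MeasurableSet {w : Om | p (pre (xs w) s)} := by
  classical
  rw [clopen_eq]
  refine Finset.measurableSet_biUnion _ fun l hl => ?_
  rw [List.mem_toFinset, List.mem_filter] at hl
  obtain ⟨w, rfl⟩ := exists_of_mem_Ls hl.1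
  exact cyl_meas w s

theorem clopen_mu (p : List ℕ → Prop) [DecidablePred p] (s : ℕ) :
    mu {w : Om | p (pre (xs w) s)} = ((Ls s).filter p).length / (Ls s).length := by
  rw [clopen_eq, measure_biUnion_finset]
  · rw [Finset.sum_congr rfl (g := fun _ => ((Ls s).length : ENNReal)⁻¹)]
    · rw [Finset.sum_const, List.toFinset_card_of_nodup ((Ls_nodup s).filter _), nsmul_eq_mul,
        ENNReal.div_eq_inv_mul, mul_comm]
    · intro l hl
      rw [List.mem_toFinset, List.mem_filter] at hl
      obtain ⟨w, rfl⟩ := exists_of_mem_Ls hl.1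
      exact cyl_mu w s
  · intro a _ b _ hab
    simp only [Function.onFun]
    rw [Set.disjoint_left]
    rintro w h1 h2
    exact hab (h1.symm.trans h2)
  · intro l hl
    rw [List.mem_toFinset, List.mem_filter] at hl
    obtain ⟨w, rfl⟩ := exists_of_mem_Ls hl.1
    exact cyl_meas w s

/-! ### Tail rainbows have positive measure -/

theorem no_three {f : ℕ → ℕ → ℕ} (hb : Bounded2Pairs f) {a b c d e g : ℕ} (h1 : a < b)
    (h2 : c < d) (h3 : e < g) (hbd : b ≠ d) (hbg : b ≠ g) (hdg : d ≠ g)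
    (e1 : f c d = f a b) (e2 : f e g = f a b) : False := by
  have h := hb (f a b)
  have hs : ({(a, b), (c, d), (e, g)} : Set (ℕ × ℕ)) ⊆
      {p : ℕ × ℕ | p.1 < p.2 ∧ f p.1 p.2 = f a b} := by
    rintro p (rfl | rfl | rfl)
    · exact ⟨h1, rfl⟩
    · exact ⟨h2, e1⟩
    · exact ⟨h3, e2⟩
  have h3 : ({(a, b), (c, d), (e, g)} : Set (ℕ × ℕ)).encard = 3 := by
    rw [Set.encard_eq_three]
    refine ⟨_, _, _, ?_, ?_, ?_, rfl⟩ <;> simp [*]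
  have := (Set.encard_le_encard hs).trans h
  rw [h3] at this
  exact absurd this (by norm_num)

theorem countP_le_one {l : List ℕ} (hl : l.Nodup) (p : ℕ → Bool)
    (h : ∀ a ∈ l, ∀ b ∈ l, p a = true → p b = true → a = b) : l.countP p ≤ 1 := by
  rw [List.countP_eq_length_filter, ← List.toFinset_card_of_nodup (hl.filter _),
    Finset.card_le_one]
  intro a ha b hb
  rw [List.mem_toFinset, List.mem_filter] at ha hb
  exact h a ha.1 b hb.1 ha.2 hb.2

/-- the event that the `n`-th element conflicts with the pair with indices `i < j < n` -/
def BadIJ (f : ℕ → ℕ → ℕ) (n i j : ℕ) (l : List ℕ) : Prop :=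
  i < j ∧ j < n ∧ ∃ k < n, f (l.getD i 0) (l.getD j 0) = f (l.getD k 0) (l.getD n 0)

theorem pre_getD (O : ℕ → ℕ) {s i : ℕ} (h : i < s) : (pre O s).getD i 0 = O i := by
  simp [pre, h]

theorem bad_mu {f : ℕ → ℕ → ℕ} (hb : Bounded2Pairs f) (n i j : ℕ) :
    mu {w : Om | BadIJ f n i j (pre (xs w) (n + 1))} ≤ ((4 * 8 ^ n : ℕ) : ENNReal)⁻¹ := by
  classical
  rw [clopen_mu]
  have hcount : ((Ls (n + 1)).filter (BadIJ f n i j)).length ≤ (Ls n).length := by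
    rw [← List.countP_eq_length_filter, Ls_succ, List.countP_flatMap]
    have : ∀ l ∈ Ls n, List.countP (fun b => decide (BadIJ f n i j b))
        ((List.range (4 * 8 ^ n)).map fun j => l ++ [4 * 8 ^ n + j]) ≤ 1 := by
      intro l hl
      obtain ⟨w, rfl⟩ := exists_of_mem_Ls hl
      rw [List.countP_map]
      apply countP_le_one List.nodup_range
      intro a ha b hb' pa pb
      simp only [Function.comp, decide_eq_true_eq] at pa pb
      obtain ⟨hij, hjn, k, hk, e⟩ := pa
      obtain ⟨-, -, k', hk', e'⟩ := pb
      have hlen : (pre (xs w) n).length = n := by simp [pre]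
      have g1 : ∀ m < n, ∀ y, (pre (xs w) n ++ [y]).getD m 0 = xs w m := by
        intro m hm y
        rw [List.getD_append _ _ _ _ (by rw [hlen]; exact hm), pre_getD _ hm]
      have g2 : ∀ y, (pre (xs w) n ++ [y]).getD n 0 = y := by
        intro y
        rw [List.getD_append_right _ _ _ _ (by rw [hlen]), hlen]
        simp
      rw [g1 _ (hij.trans hjn), g1 _ hjn, g1 _ hk, g2] at e
      rw [g1 _ (hij.trans hjn), g1 _ hjn, g1 _ hk', g2] at e'
      have hlt : ∀ m < n, xs w m < 4 * 8 ^ n := by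
        intro m hm
        have h1 := xs_lt w m
        have h2 : 8 ^ (m + 1) ≤ 8 ^ n := Nat.pow_le_pow_right (by norm_num) hm
        have h3 : 8 ^ (m + 1) = 8 * 8 ^ m := by ring
        omega
      by_contra hab
      have l1 := hlt _ hjn
      have l2 := hlt _ hk
      have l3 := hlt _ hk'
      exact no_three hb (xs_strictMono w hij) (c := xs w k) (d := 4 * 8 ^ n + a)
        (e := xs w k') (g := 4 * 8 ^ n + b) (by omega) (by omega) (by omega) (by omega)
        (by omega) e.symm e'.symm
    refine (List.sum_le_card_nsmul _ 1 ?_).trans ?_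
    · intro x hx
      obtain ⟨l, hl, rfl⟩ := List.mem_map.1 hx
      exact this l hl
    · simp
  have hpos : ((Ls n).length : ENNReal) ≠ 0 := by
    exact_mod_cast (Ls_length_pos n).ne'
  calc (((Ls (n + 1)).filter (BadIJ f n i j)).length : ENNReal) / (Ls (n + 1)).length
      ≤ ((Ls n).length : ENNReal) / (Ls (n + 1)).length := by
        gcongr
    _ = ((4 * 8 ^ n : ℕ) : ENNReal)⁻¹ := by
        rw [Ls_length_succ, Nat.cast_mul, ENNReal.div_eq_inv_mul,
          ENNReal.mul_inv (Or.inl hpos) (Or.inl (ENNReal.natCast_ne_top _)), mul_right_comm,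
          ENNReal.inv_mul_cancel hpos (ENNReal.natCast_ne_top _), one_mul]

/-- the set of samples that produce a conflict -/
def Bad (f : ℕ → ℕ → ℕ) : Set Om :=
  ⋃ n : ℕ, ⋃ q ∈ (Finset.range n) ×ˢ (Finset.range n),
    {w : Om | BadIJ f n q.1 q.2 (pre (xs w) (n + 1))}

theorem Bad_mu {f : ℕ → ℕ → ℕ} (hb : Bounded2Pairs f) : mu (Bad f) ≤ 2⁻¹ := by
  have h1 : ∀ n : ℕ, mu (⋃ q ∈ (Finset.range n) ×ˢ (Finset.range n),
      {w : Om | BadIJ f n q.1 q.2 (pre (xs w) (n + 1))}) ≤ 4⁻¹ * 2⁻¹ ^ n := by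
    intro n
    refine (measure_biUnion_finset_le _ _).trans ?_
    refine (Finset.sum_le_sum fun q _ => bad_mu hb n q.1 q.2).trans ?_
    rw [Finset.sum_const, Finset.card_product, Finset.card_range, nsmul_eq_mul]
    have hn : n * n ≤ 4 ^ n := by
      have : n ≤ 2 ^ n := Nat.lt_two_pow_self.le
      calc n * n ≤ 2 ^ n * 2 ^ n := Nat.mul_le_mul this this
        _ = 4 ^ n := by rw [← mul_pow]; norm_num
    calc ((n * n : ℕ) : ENNReal) * ((4 * 8 ^ n : ℕ) : ENNReal)⁻¹
        ≤ ((4 ^ n : ℕ) : ENNReal) * ((4 * 8 ^ n : ℕ) : ENNReal)⁻¹ := by gcongr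
      _ = 4⁻¹ * 2⁻¹ ^ n := by
        have h8 : (4 * 8 ^ n : ℕ) = 4 ^ n * (4 * 2 ^ n) := by
          rw [show (8 : ℕ) = 4 * 2 from rfl, mul_pow]; ring
        have hp : ((4 ^ n : ℕ) : ENNReal) ≠ 0 := by positivity
        rw [h8, Nat.cast_mul, ENNReal.mul_inv (Or.inl hp) (Or.inl (ENNReal.natCast_ne_top _)),
          ← mul_assoc, ENNReal.mul_inv_cancel hp (ENNReal.natCast_ne_top _), one_mul, Nat.cast_mul,
          ENNReal.mul_inv (Or.inl (by norm_num)) (Or.inl (ENNReal.natCast_ne_top _))]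
        push_cast
        rw [ENNReal.inv_pow]
  refine (measure_iUnion_le _).trans ((ENNReal.tsum_le_tsum h1).trans ?_)
  rw [ENNReal.tsum_mul_left, ENNReal.tsum_geometric, ENNReal.one_sub_inv_two, inv_inv,
    show (4 : ENNReal) = 2 * 2 by norm_num, ENNReal.mul_inv (by simp) (by simp), mul_assoc,
    ENNReal.inv_mul_cancel (by simp) (by simp), mul_one]

theorem rainbow_of_not_bad {f : ℕ → ℕ → ℕ} {w : Om} (hw : w ∉ Bad f) :
    TailRainbowOn f (Set.range (xs w)) := by
  have key : ∀ i j k n, i < j → k < n → j < n → f (xs w i) (xs w j) ≠ f (xs w k) (xs w n) := by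
    intro i j k n hij hkn hjn e
    apply hw
    simp only [Bad, Set.mem_iUnion]
    refine ⟨n, (i, j), ?_, hij, hjn, k, hkn, ?_⟩
    · simp only [Finset.mem_product, Finset.mem_range]
      omega
    · rw [pre_getD _ (by omega), pre_getD _ (by omega), pre_getD _ (by omega),
        pre_getD _ (by omega)]
      exact e
  rintro _ _ _ _ ⟨i, rfl⟩ ⟨j, rfl⟩ ⟨k, rfl⟩ ⟨n, rfl⟩ h1 h2 hne
  rw [(xs_strictMono w).lt_iff_lt] at h1 h2
  have hjn : j ≠ n := fun h => hne (h ▸ rfl)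
  rcases lt_or_gt_of_ne hjn with h | h
  · exact key _ _ _ _ h1 h2 h
  · exact (key _ _ _ _ h2 h1 h).symm

/-! ### Theorem of Sacks -/

/-- initial segment of the join from initial segments -/
def Gj (l z : List ℕ) : List ℕ :=
  (List.range l.length).map fun i =>
    if i % 2 = 0 then (if ∃ a ∈ l, a = i / 2 then 1 else 0) else z.getD (i / 2) 0

theorem Gj_primrec : Primrec₂ Gj := by
  have hi : Primrec (fun q : (List ℕ × List ℕ) × ℕ => q.2 / 2) :=
    Primrec.nat_div.comp Primrec.snd (Primrec.const 2)
  have hm : PrimrecRel (fun (l : List ℕ) (b : ℕ) => ∃ a ∈ l, a = b) :=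
    PrimrecRel.exists_mem_list Primrec.eq
  have h2 : PrimrecPred (fun q : (List ℕ × List ℕ) × ℕ => ∃ a ∈ q.1.1, a = q.2 / 2) :=
    hm.comp (Primrec.fst.comp Primrec.fst) hi
  have h3 : PrimrecPred (fun q : (List ℕ × List ℕ) × ℕ => q.2 % 2 = 0) :=
    Primrec.eq.comp (Primrec.nat_mod.comp Primrec.snd (Primrec.const 2)) (Primrec.const 0)
  refine Primrec.list_map (Primrec.list_range.comp (Primrec.list_length.comp Primrec.fst)) ?_
  refine Primrec.ite h3 (Primrec.ite h2 (Primrec.const 1) (Primrec.const 0)) ?_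
  exact (Primrec.list_getD 0).comp (Primrec.snd.comp Primrec.fst) hi

theorem Gj_eq (w : Om) (Z : Set ℕ) {s t : ℕ} (h : s ≤ t) :
    pre (chi (join (Set.range (xs w)) Z)) s = Gj (pre (xs w) s) (pre (chi Z) t) := by
  have hlen : (pre (xs w) s).length = s := by simp [pre]
  unfold Gj
  rw [hlen]
  unfold pre
  apply List.map_congr_left
  intro i hi
  rw [List.mem_range] at hi
  classical
  simp only [chi, Set.indicator_apply]
  rcases Nat.even_or_odd' i with ⟨k, rfl | rfl⟩
  · have hmem : 2 * k ∈ join (Set.range (xs w)) Z ↔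
        ∃ a ∈ List.map (xs w) (List.range s), a = 2 * k / 2 := by
      simp only [join, List.mem_map, List.mem_range]
      constructor
      · rintro (⟨_, ⟨m, rfl⟩, e⟩ | ⟨m, _, e⟩)
        · have : m ≤ xs w m := (xs_strictMono w).le_apply
          exact ⟨xs w m, ⟨m, by omega, rfl⟩, by omega⟩
        · omega
      · rintro ⟨_, ⟨m, _, rfl⟩, e⟩
        exact Or.inl ⟨_, ⟨m, rfl⟩, by omega⟩
    rw [if_pos (show 2 * k % 2 = 0 by omega)]
    simp only [hmem]
  · have hmem : 2 * k + 1 ∈ join (Set.range (xs w)) Z ↔ k ∈ Z := by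
      constructor
      · rintro (⟨_, _, e⟩ | ⟨m, hm, e⟩)
        · omega
        · obtain rfl : k = m := by omega
          exact hm
      · exact fun h => Or.inr ⟨k, h, rfl⟩
    rw [if_neg (show ¬ (2 * k + 1) % 2 = 0 by omega)]
    have e : (2 * k + 1) / 2 = k := by omega
    have := pre_getD (chi Z) (s := t) (i := k) (by omega)
    unfold pre at this
    simp only [chi, Set.indicator_apply] at this
    rw [e, this]
    simp only [hmem]

theorem Ls_primrec : Primrec Ls := by
  have hk : Primrec (fun s : ℕ => 4 * 8 ^ s) := by
    have : Primrec (fun s : ℕ => Nat.rec (motive := fun _ => ℕ) 4 (fun _ r => r * 8) s) := by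
      have h8 : Primrec₂ (fun (_ : ℕ) (r : ℕ × ℕ) => r.2 * 8) :=
        Primrec.nat_mul.comp (Primrec.snd.comp Primrec.snd) (Primrec.const 8)
      exact Primrec.nat_rec' Primrec.id (Primrec.const 4) h8
    refine this.of_eq fun s => ?_
    induction s with
    | zero => rfl
    | succ s ih => simp only [ih]; ring
  have hstep : Primrec₂ (fun (_ : ℕ) (r : ℕ × List (List ℕ)) => r.2.flatMap fun l =>
      (List.range (4 * 8 ^ r.1)).map fun j => l ++ [4 * 8 ^ r.1 + j]) := by
    refine Primrec.list_flatMap (Primrec.snd.comp Primrec.snd) ?_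
    have hr : Primrec (fun q : (ℕ × (ℕ × List (List ℕ))) × List ℕ => 4 * 8 ^ q.1.2.1) :=
      hk.comp (Primrec.fst.comp (Primrec.snd.comp Primrec.fst))
    refine Primrec.list_map (Primrec.list_range.comp hr) ?_
    refine Primrec.list_append.comp (Primrec.snd.comp Primrec.fst) ?_
    exact Primrec.list_cons.comp (Primrec.nat_add.comp (hr.comp Primrec.fst) Primrec.snd)
      (Primrec.const [])
  exact Primrec.nat_rec' Primrec.id (Primrec.const [[]]) hstep

/-- the finite test used by the majority vote -/
def Tst (F : List ℕ → ℕ → Option ℕ) (c : List (Option ℕ)) (N : ℕ) (l : List ℕ)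
    (q : ℕ × ℕ × List ℕ) : Prop :=
  (List.range N).map (F (Gj l q.2.2)) = c ∧ F (Gj l q.2.2) q.1 = some q.2.1

instance instDecTst (F : List ℕ → ℕ → Option ℕ) (c : List (Option ℕ)) (N : ℕ) :
    DecidableRel (Tst F c N) := fun _ _ => instDecidableAnd

theorem Tst_primrec {F : List ℕ → ℕ → Option ℕ} (hF : Primrec₂ F) (c : List (Option ℕ)) (N : ℕ) :
    PrimrecRel (Tst F c N) := by
  have hg : Primrec (fun r : List ℕ × (ℕ × ℕ × List ℕ) => Gj r.1 r.2.2.2) :=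
    Gj_primrec.comp Primrec.fst (Primrec.snd.comp (Primrec.snd.comp Primrec.snd))
  refine PrimrecPred.and (Primrec.eq.comp ?_ (Primrec.const c)) (Primrec.eq.comp ?_ ?_)
  · exact Primrec.list_map (Primrec.const (List.range N))
      (hF.comp (hg.comp Primrec.fst) Primrec.snd)
  · exact hF.comp hg (Primrec.fst.comp Primrec.snd)
  · exact Primrec.option_some.comp (Primrec.fst.comp (Primrec.snd.comp Primrec.snd))

theorem exists_nat_div_btwn {x y : ENNReal} (h : x < y) :
    ∃ a b : ℕ, b ≠ 0 ∧ x < (a : ENNReal) / b ∧ (a : ENNReal) / b < y := by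
  obtain ⟨q, hq, h1, h2⟩ := ENNReal.lt_iff_exists_rat_btwn.1 h
  have e : ((Real.toNNReal q : NNReal) : ENNReal) = (q.num.toNat : ENNReal) / q.den := by
    have hn : ((q.num.toNat : ℕ) : ℤ) = q.num := Int.toNat_of_nonneg (Rat.num_nonneg.2 hq)
    have hq2 : (q : ℝ) = (q.num.toNat : ℝ) / q.den := by
      have h3 : ((q.num.toNat : ℕ) : ℝ) = (q.num : ℝ) := by exact_mod_cast hn
      rw [h3, Rat.cast_def]
    have hd : (0 : ℝ) < q.den := by exact_mod_cast q.den_pos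
    change ENNReal.ofReal q = _
    rw [hq2, ENNReal.ofReal_div_of_pos hd, ENNReal.ofReal_natCast, ENNReal.ofReal_natCast]
  exact ⟨q.num.toNat, q.den, q.den_ne_zero, e ▸ h1, e ▸ h2⟩

theorem nat_div_lt_iff {a b c d : ℕ} (hb : b ≠ 0) (hd : d ≠ 0) :
    (a : ENNReal) / b < (c : ENNReal) / d ↔ a * d < b * c := by
  have hb' : (0 : ℝ) < b := by positivity
  have hd' : (0 : ℝ) < d := by positivity
  rw [← ENNReal.ofReal_natCast a, ← ENNReal.ofReal_natCast b, ← ENNReal.ofReal_natCast c,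
    ← ENNReal.ofReal_natCast d, ← ENNReal.ofReal_div_of_pos hb', ← ENNReal.ofReal_div_of_pos hd',
    ENNReal.ofReal_lt_ofReal_iff_of_nonneg (by positivity), div_lt_div_iff₀ hb' hd', mul_comm (c : ℝ)]
  exact_mod_cast Iff.rfl

theorem sacks (W Z : Set ℕ) (hWZ : ¬ TuringLE W Z) {F : List ℕ → ℕ → Option ℕ} (hF : IsFun F) :
    mu {w : Om | ∀ n, ∃ s, F (pre (chi (join (Set.range (xs w)) Z)) s) n = some (chi W n)} = 0 := by
  by_contra hpos
  apply hWZ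
  set A : Set Om :=
    {w : Om | ∀ n, ∃ s, F (pre (chi (join (Set.range (xs w)) Z)) s) n = some (chi W n)} with hA
  let D : ℕ → Set Om := fun N =>
    ⋃ s, {w : Om | ∀ i < N, F (Gj (pre (xs w) s) (pre (chi Z) s)) i = some (chi W i)}
  have hDmeas : ∀ N, MeasurableSet (D N) := fun N => MeasurableSet.iUnion fun s =>
    clopen_meas (fun l => ∀ i < N, F (Gj l (pre (chi Z) s)) i = some (chi W i)) s
  have hD : ∀ N w, w ∈ D N ↔ ∃ s, ∀ i < N,
      F (pre (chi (join (Set.range (xs w)) Z)) s) i = some (chi W i) := by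
    intro N w
    simp only [D, Set.mem_iUnion]
    refine exists_congr fun s => ?_
    rw [Gj_eq w Z le_rfl]
    rfl
  have hDanti : Antitone D := by
    intro N M h w hw
    rw [hD] at hw ⊢
    obtain ⟨s, hs⟩ := hw
    exact ⟨s, fun i hi => hs i (hi.trans_le h)⟩
  have hAD : A = ⋂ N, D N := by
    ext w
    rw [Set.mem_iInter]
    constructor
    · intro hw N
      rw [hD]
      choose s hs using hw
      refine ⟨(Finset.range N).sup s, fun i hi => hF.pre_mono _ ?_ (hs i)⟩
      exact Finset.le_sup (f := s) (Finset.mem_range.2 hi)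
    · intro hw n
      obtain ⟨s, hs⟩ := (hD _ _).1 (hw (n + 1))
      exact ⟨s, hs n (Nat.lt_succ_self n)⟩
  have hAmeas : MeasurableSet A := hAD ▸ MeasurableSet.iInter hDmeas
  have hmuA : mu A = ⨅ N, mu (D N) := by
    rw [hAD]
    exact hDanti.measure_iInter (fun N => (hDmeas N).nullMeasurableSet) ⟨0, measure_ne_top _ _⟩
  obtain ⟨N, hN⟩ : ∃ N, mu (D N) < mu A + mu A := by
    apply iInf_lt_iff.1
    rw [← hmuA]
    exact ENNReal.lt_add_right (measure_ne_top _ _) hpos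
  have hsub : A ⊆ D N := hAD ▸ Set.iInter_subset _ N
  have hdiff : mu (D N \ A) < mu A := by
    rw [measure_sdiff hsub hAmeas.nullMeasurableSet (measure_ne_top _ _)]
    exact ENNReal.sub_lt_of_lt_add (measure_mono hsub) hN
  obtain ⟨a, b, hb, hlo, hhi⟩ := exists_nat_div_btwn hdiff
  let c : List (Option ℕ) := (List.range N).map fun i => some (chi W i)
  let E : ℕ → ℕ → ℕ → ℕ → Set Om := fun n v s t =>
    {w : Om | Tst F c N (pre (xs w) s) (n, v, pre (chi Z) t)}
  have hE : ∀ n v s t, s ≤ t → ∀ w, w ∈ E n v s t ↔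
      (∀ i < N, F (pre (chi (join (Set.range (xs w)) Z)) s) i = some (chi W i)) ∧
      F (pre (chi (join (Set.range (xs w)) Z)) s) n = some v := by
    intro n v s t hst w
    rw [Gj_eq w Z hst]
    change Tst F c N _ _ ↔ _
    simp only [Tst, c, List.map_inj_left, List.mem_range]
  let H : ℕ → ℕ → List ℕ → Bool := fun n m z =>
    decide (a * (Ls m.unpair.1).length <
      b * ((Ls m.unpair.1).filter fun l => Tst F c N l (n, m.unpair.2, z)).length)
  have hH : Primrec (fun p : ℕ × ℕ × List ℕ => H p.1 p.2.1 p.2.2) := by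
    have u1 : Primrec (fun p : ℕ × ℕ × List ℕ => p.2.1.unpair.1) :=
      Primrec.fst.comp (Primrec.unpair.comp (Primrec.fst.comp Primrec.snd))
    have u2 : Primrec (fun p : ℕ × ℕ × List ℕ => p.2.1.unpair.2) :=
      Primrec.snd.comp (Primrec.unpair.comp (Primrec.fst.comp Primrec.snd))
    have hL := Ls_primrec.comp u1
    have hf := (Tst_primrec hF.prim c N).listFilter
    have hq : Primrec (fun p : ℕ × ℕ × List ℕ => (p.1, p.2.1.unpair.2, p.2.2)) :=
      Primrec.fst.pair (u2.pair (Primrec.snd.comp Primrec.snd))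
    have h1 := Primrec.nat_mul.comp (Primrec.const a) (Primrec.list_length.comp hL)
    have h2 := Primrec.nat_mul.comp (Primrec.const b) (Primrec.list_length.comp (hf.comp hL hq))
    exact (Primrec.nat_lt.comp h1 h2).decide
  have hHE : ∀ n m, H n m (pre (chi Z) m) = true ↔
      (a : ENNReal) / b < mu (E n m.unpair.2 m.unpair.1 m) := by
    intro n m
    simp only [H, E, decide_eq_true_eq]
    rw [clopen_mu (fun l => Tst F c N l (n, m.unpair.2, pre (chi Z) m)),
      nat_div_lt_iff hb (Ls_length_pos _).ne']
  refine rec_search (chi Z) H hH (chi W) ?_ ?_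
  · intro n
    have hmono : Monotone (fun s => E n (chi W n) s s) := by
      intro s t hst w hw
      rw [hE _ _ _ _ le_rfl] at hw ⊢
      exact ⟨fun i hi => hF.pre_mono _ hst (hw.1 i hi), hF.pre_mono _ hst hw.2⟩
    have hcov : A ⊆ ⋃ s, E n (chi W n) s s := by
      intro w hw
      obtain ⟨s, hs⟩ := (hD _ _).1 (hsub hw)
      obtain ⟨t, ht⟩ := hw n
      refine Set.mem_iUnion.2 ⟨max s t, ?_⟩
      rw [hE _ _ _ _ le_rfl]
      exact ⟨fun i hi => hF.pre_mono _ (le_max_left _ _) (hs i hi),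
        hF.pre_mono _ (le_max_right _ _) ht⟩
    have h1 := hhi.trans_le (measure_mono (μ := mu) hcov)
    rw [hmono.measure_iUnion, lt_iSup_iff] at h1
    obtain ⟨s, hs⟩ := h1
    refine ⟨Nat.pair s (chi W n), (hHE _ _).2 ?_⟩
    rw [Nat.unpair_pair]
    have : E n (chi W n) s (Nat.pair s (chi W n)) = E n (chi W n) s s := by
      ext w
      rw [hE _ _ _ _ le_rfl, hE _ _ _ _ (Nat.left_le_pair _ _)]
    rw [this]
    exact hs
  · intro n m h
    rw [hHE] at h
    by_contra hne
    refine absurd (h.trans_le (measure_mono (μ := mu) ?_)) hlo.not_gt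
    intro w hw
    rw [hE _ _ _ _ (Nat.unpair_left_le m)] at hw
    refine ⟨(hD _ _).2 ⟨_, hw.1⟩, fun hwA => ?_⟩
    obtain ⟨t, ht⟩ := hwA n
    exact hne (hF.uniq _ hw.2 ht)

/-- if `W ≰_T Z`, then every 2-bounded coloring `f` of `[ℕ]²` (no
computability hypothesis) admits an infinite tail `f`-rainbow `X` with `W ≰_T X ⊕ Z`. -/
theorem statement3 (W Z : Set ℕ) (hWZ : ¬ TuringLE W Z) (f : ℕ → ℕ → ℕ)
    (hbounded : Bounded2Pairs f) :
    ∃ X : Set ℕ, X.Infinite ∧ TailRainbowOn f X ∧ ¬ TuringLE W (join X Z) := by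
  by_contra hcon
  push Not at hcon
  have hcov : (Set.univ : Set Om) ⊆ Bad f ∪ ⋃ F ∈ {F | IsFun F},
      {w : Om | ∀ n, ∃ s, F (pre (chi (join (Set.range (xs w)) Z)) s) n = some (chi W n)} := by
    intro w _
    by_cases hw : w ∈ Bad f
    · exact Or.inl hw
    · right
      obtain ⟨F, hF, rF⟩ := use_principle (hcon (Set.range (xs w))
        (Set.infinite_range_of_injective (xs_strictMono w).injective) (rainbow_of_not_bad hw))
      refine Set.mem_biUnion (show F ∈ {F | IsFun F} from hF) ?_
      intro n
      exact (rF n (chi W n)).1 (Part.mem_some _)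
  have h0 : mu (⋃ F ∈ {F | IsFun F},
      {w : Om | ∀ n, ∃ s, F (pre (chi (join (Set.range (xs w)) Z)) s) n = some (chi W n)}) = 0 :=
    (measure_biUnion_null_iff countable_isFun).2 fun F hF => sacks W Z hWZ hF
  have h1 := (measure_mono (μ := mu) hcov).trans (measure_union_le _ _)
  rw [h0, add_zero, measure_univ] at h1
  have h2 := h1.trans (Bad_mu hbounded)
  exact absurd h2 (by norm_num)

end RRT
end

section
/- Define h : ℕ → ℕ by h(k) = k for k ≤ 2 and h(k) = h(k−1) + min{2^m : 2^m ≥ 2^{k−1}·(k−1)(k−2)/2} for k > 2. Let f : [ℕ]^2 → ℕ be a 2-bounded coloring. Let S be the set of finite strictly increasing sequences σ such that h(k) ≤ σ(k) < h(k+1) for all k < |σ|, and let T = {σ ∈ S : σ is a tail rainbow for f}. Then for every k, |T ∩ [ℕ]^k| ≥ (1/2)·|S ∩ [ℕ]^k|. -/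
namespace RRT

/-- The least power of two that is `≥ N`. -/
noncomputable def pow2ge (N : ℕ) : ℕ := sInf {p : ℕ | (∃ m : ℕ, p = 2 ^ m) ∧ N ≤ p}

/-- `hfun k = k` for `k ≤ 2`, and
`hfun k = hfun (k-1) + min {2^m : 2^m ≥ 2^(k-1) · (k-1)(k-2)/2}` for `k > 2`. -/
noncomputable def hfun : ℕ → ℕ
  | 0 => 0
  | 1 => 1
  | 2 => 2
  | k + 3 => hfun (k + 2) + pow2ge (2 ^ (k + 2) * ((k + 2) * (k + 1) / 2))

lemma le_pow2ge (N : ℕ) : N ≤ pow2ge N := by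
  have h : {p : ℕ | (∃ m : ℕ, p = 2 ^ m) ∧ N ≤ p}.Nonempty :=
    ⟨2 ^ N, ⟨N, rfl⟩, Nat.lt_two_pow_self.le⟩
  exact (Nat.sInf_mem h).2

/-- Width of the `k`-th interval. -/
noncomputable def wid (k : ℕ) : ℕ := hfun (k + 1) - hfun k

lemma hfun_step (k : ℕ) (hk : 2 ≤ k) : hfun k + 2 ^ k * (k * (k - 1) / 2) ≤ hfun (k + 1) := by
  obtain ⟨j, rfl⟩ := Nat.exists_eq_add_of_le' hk
  have := le_pow2ge (2 ^ (j + 2) * ((j + 2) * (j + 1) / 2))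
  have e : hfun (j + 2 + 1) = hfun (j + 2) + pow2ge (2 ^ (j + 2) * ((j + 2) * (j + 1) / 2)) := by
    rw [hfun]
  have e2 : j + 2 - 1 = j + 1 := by omega
  rw [e, e2]
  omega

lemma hfun_mono : Monotone hfun := by
  refine monotone_nat_of_le_succ fun k => ?_
  rcases lt_or_ge k 2 with h | h
  · interval_cases k <;> simp [hfun]
  · have := hfun_step k h
    omega

lemma wid_ge (k : ℕ) (hk : 2 ≤ k) : 2 ^ k * (k * (k - 1) / 2) ≤ wid k := by
  have := hfun_step k hk
  unfold wid
  omega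

/-- The set `S` at length `k`, as a finset. -/
noncomputable def SS (k : ℕ) : Finset (Fin k → ℕ) :=
  Fintype.piFinset fun i : Fin k => Finset.Ico (hfun i) (hfun ((i : ℕ) + 1))

open Classical in
/-- The set `T` at length `k`, as a finset. -/
noncomputable def TT (f : ℕ → ℕ → ℕ) (k : ℕ) : Finset (Fin k → ℕ) :=
  (SS k).filter fun σ => TailRainbowOn f (Set.range σ)

lemma SS_card_succ (k : ℕ) : (SS (k + 1)).card = (SS k).card * wid k := by
  unfold SS wid
  rw [Fintype.card_piFinset, Fintype.card_piFinset, Fin.prod_univ_castSucc]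
  simp

lemma mem_SS {k : ℕ} {σ : Fin k → ℕ} :
    σ ∈ SS k ↔ ∀ i : Fin k, hfun (i : ℕ) ≤ σ i ∧ σ i < hfun ((i : ℕ) + 1) := by
  simp [SS]

lemma SS_strictMono {k : ℕ} {σ : Fin k → ℕ} (h : σ ∈ SS k) : StrictMono σ := by
  rw [mem_SS] at h
  intro i j hij
  have h1 : hfun ((i : ℕ) + 1) ≤ hfun j := hfun_mono (by exact hij)
  exact lt_of_lt_of_le (h i).2 (h1.trans (h j).1)

lemma unique_bad {f : ℕ → ℕ → ℕ} (hb : Bounded2Pairs f) {y0 y1 x0 x x0' x' : ℕ}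
    (hy : y0 < y1) (hx : x0 < x) (hx' : x0' < x') (h1 : x ≠ y1) (h1' : x' ≠ y1)
    (e : f x0 x = f y0 y1) (e' : f x0' x' = f y0 y1) : x = x' := by
  by_contra hne
  have hsub : ({(y0, y1), (x0, x), (x0', x')} : Set (ℕ × ℕ)) ⊆
      {p : ℕ × ℕ | p.1 < p.2 ∧ f p.1 p.2 = f y0 y1} := by
    rintro p (rfl | rfl | rfl)
    · exact ⟨hy, rfl⟩
    · exact ⟨hx, e⟩
    · exact ⟨hx', e'⟩
  have h3 : ({(y0, y1), (x0, x), (x0', x')} : Set (ℕ × ℕ)).encard = 3 := by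
    rw [Set.encard_eq_three]
    refine ⟨_, _, _, ?_, ?_, ?_, rfl⟩ <;> simp <;> intros <;> omega
  have := (Set.encard_le_encard hsub).trans (hb (f y0 y1))
  rw [h3] at this
  exact absurd this (by decide)

open Classical in
/-- Bad one-point extensions of `σ` caused by a pair. -/
noncomputable def bad (f : ℕ → ℕ → ℕ) {k : ℕ} (σ : Fin k → ℕ) : Finset ℕ :=
  ((Finset.univ : Finset (Fin k)).sigma fun j => Finset.Iio j).biUnion fun p =>
    (Finset.Ico (hfun k) (hfun (k + 1))).filter fun x =>
      ∃ x0 < x, x ≠ σ p.1 ∧ f x0 x = f (σ p.2) (σ p.1)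

lemma bad_card {f : ℕ → ℕ → ℕ} (hb : Bounded2Pairs f) {k : ℕ} {σ : Fin k → ℕ}
    (hσ : StrictMono σ) : (bad f σ).card ≤ k * (k - 1) / 2 := by
  classical
  unfold bad
  refine (Finset.card_biUnion_le_card_mul _ _ 1 ?_).trans ?_
  · rintro ⟨j, i⟩ hp
    have hij : i < j := by simpa using hp
    rw [Finset.card_le_one]
    intro a ha b hb'
    obtain ⟨-, x0, hx, hne, e⟩ := Finset.mem_filter.1 ha
    obtain ⟨-, x0', hx', hne', e'⟩ := Finset.mem_filter.1 hb'
    exact unique_bad hb (hσ hij) hx hx' hne hne' e e'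
  · rw [mul_one, Finset.card_sigma]
    simp only [Fin.card_Iio]
    rw [Fin.sum_univ_eq_sum_range (fun i => i), Finset.sum_range_id]

lemma snoc_mem {f : ℕ → ℕ → ℕ} {k : ℕ} {σ : Fin k → ℕ} (hσ : σ ∈ TT f k) {x : ℕ}
    (hx : x ∈ Finset.Ico (hfun k) (hfun (k + 1))) (hxb : x ∉ bad f σ) :
    (Fin.snoc σ x : Fin (k + 1) → ℕ) ∈ TT f (k + 1) := by
  classical
  obtain ⟨hS, hT⟩ := Finset.mem_filter.1 hσ
  have hm := SS_strictMono hS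
  have hlt : ∀ i, σ i < x := fun i => by
    have h1 := (mem_SS.1 hS i).2
    have h2 : hfun ((i : ℕ) + 1) ≤ hfun k := hfun_mono i.2
    have h3 := (Finset.mem_Ico.1 hx).1
    omega
  have key : ∀ x0 i j, x0 < x → σ i < σ j → f x0 x ≠ f (σ i) (σ j) := by
    intro x0 i j h0 hij e
    apply hxb
    unfold bad
    refine Finset.mem_biUnion.2 ⟨⟨j, i⟩, ?_, Finset.mem_filter.2 ⟨hx, x0, h0, (hlt j).ne', e⟩⟩
    simpa using hm.lt_iff_lt.1 hij
  refine Finset.mem_filter.2 ⟨mem_SS.2 fun i => ?_, ?_⟩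
  · refine Fin.lastCases ?_ (fun i => ?_) i
    · simpa using hx
    · simpa using mem_SS.1 hS i
  · have hr : ∀ a ∈ Set.range (Fin.snoc σ x : Fin (k + 1) → ℕ), a = x ∨ ∃ i, σ i = a := by
      rintro _ ⟨i, rfl⟩
      refine Fin.lastCases ?_ (fun i => ?_) i <;> simp
    intro x0 x1 y0 y1 hx0 hx1 hy0 hy1 h0 h1 hne
    rcases hr _ hx1 with rfl | ⟨i, rfl⟩
    · rcases hr _ hy1 with rfl | ⟨j, rfl⟩
      · exact absurd rfl hne
      · rcases hr _ hy0 with rfl | ⟨j', rfl⟩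
        · exact absurd (hlt j) (by omega)
        · exact key _ _ _ h0 h1
    · rcases hr _ hx0 with rfl | ⟨i', rfl⟩
      · exact absurd (hlt i) (by omega)
      rcases hr _ hy1 with rfl | ⟨j, rfl⟩
      · exact (key _ _ _ h1 h0).symm
      · rcases hr _ hy0 with rfl | ⟨j', rfl⟩
        · exact absurd (hlt j) (by omega)
        · exact hT _ _ _ _ ⟨_, rfl⟩ ⟨_, rfl⟩ ⟨_, rfl⟩ ⟨_, rfl⟩ h0 h1 hne

lemma TT_card_succ {f : ℕ → ℕ → ℕ} (hb : Bounded2Pairs f) (k : ℕ) :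
    (TT f k).card * (wid k - k * (k - 1) / 2) ≤ (TT f (k + 1)).card := by
  classical
  have h1 : ((TT f k).sigma fun σ => Finset.Ico (hfun k) (hfun (k + 1)) \ bad f σ).card ≤
      (TT f (k + 1)).card := by
    refine Finset.card_le_card_of_injOn (fun p => (Fin.snoc p.1 p.2 : Fin (k + 1) → ℕ)) ?_ ?_
    · rintro ⟨σ, x⟩ hp
      have hp' := Finset.mem_sigma.1 hp
      have h2 := Finset.mem_sdiff.1 hp'.2
      exact snoc_mem hp'.1 h2.1 h2.2
    · rintro ⟨σ, x⟩ - ⟨τ, y⟩ - e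
      obtain ⟨rfl, rfl⟩ := Fin.snoc_inj.1 e
      rfl
  refine le_trans ?_ h1
  rw [Finset.card_sigma, ← smul_eq_mul]
  refine Finset.card_nsmul_le_sum _ _ _ fun σ hσ => ?_
  have h3 := bad_card hb (SS_strictMono (Finset.mem_filter.1 hσ).1)
  have h4 := Finset.le_card_sdiff (bad f σ) (Finset.Ico (hfun k) (hfun (k + 1)))
  rw [Nat.card_Ico] at h4
  unfold wid
  omega

lemma main_inv {f : ℕ → ℕ → ℕ} (hb : Bounded2Pairs f) (k : ℕ) (hk : 2 ≤ k) :
    (SS k).card * (2 ^ k + 4) ≤ 2 ^ (k + 1) * (TT f k).card := by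
  classical
  induction k, hk using Nat.le_induction with
  | base =>
    have w0 : wid 0 = 1 := by simp [wid, hfun]
    have w1 : wid 1 = 1 := by simp [wid, hfun]
    have s0 : (SS 0).card = 1 := by simp [SS]
    have s1 := SS_card_succ 0
    have s2 := SS_card_succ 1
    have t1 := TT_card_succ hb 0
    have t2 := TT_card_succ hb 1
    have t0 : 1 ≤ (TT f 0).card := by
      refine Finset.card_pos.2 ⟨Fin.elim0, Finset.mem_filter.2 ⟨mem_SS.2 fun i => i.elim0, ?_⟩⟩
      rintro x0 x1 y0 y1 ⟨i, -⟩
      exact i.elim0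
    simp [w0, w1, s0] at s1 s2 t1 t2
    rw [s1] at s2
    simp only [s2]
    omega
  | succ k hk ih =>
    have hw := wid_ge k hk
    have ht := TT_card_succ hb k
    rw [SS_card_succ]
    generalize k * (k - 1) / 2 = c at *
    generalize (SS k).card = s at *
    generalize (TT f k).card = t at *
    generalize (TT f (k + 1)).card = t' at *
    generalize wid k = w at *
    have hP : 4 ≤ 2 ^ k := by
      calc 4 = 2 ^ 2 := rfl
        _ ≤ 2 ^ k := Nat.pow_le_pow_right (by norm_num) hk
    rw [pow_succ] at ih
    rw [pow_succ 2 (k + 1), pow_succ 2 k]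
    generalize 2 ^ k = P at *
    have hcw : c ≤ w := by nlinarith
    obtain ⟨d, rfl⟩ := Nat.exists_eq_add_of_le hcw
    rw [Nat.add_sub_cancel_left] at ht
    have hd : (c + d) * (P - 1) ≤ P * d := by
      obtain ⟨Q, rfl⟩ := Nat.exists_eq_add_of_le' (by omega : 1 ≤ P)
      rw [Nat.add_sub_cancel]
      nlinarith
    obtain ⟨Q, rfl⟩ := Nat.exists_eq_add_of_le' (by omega : 1 ≤ P)
    rw [Nat.add_sub_cancel] at hd
    have hPQ : (2 * (Q + 1) + 4) * (Q + 1) ≤ 2 * ((Q + 1) + 4) * Q := by nlinarith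
    refine Nat.le_of_mul_le_mul_right ?_ (by omega : 0 < Q + 1)
    calc s * (c + d) * ((Q + 1) * 2 + 4) * (Q + 1)
        = s * (c + d) * ((2 * (Q + 1) + 4) * (Q + 1)) := by ring
      _ ≤ s * (c + d) * (2 * ((Q + 1) + 4) * Q) := by gcongr
      _ = 2 * (s * ((Q + 1) + 4)) * ((c + d) * Q) := by ring
      _ ≤ 2 * ((Q + 1) * 2 * t) * ((Q + 1) * d) := by gcongr
      _ = (Q + 1) * 2 * 2 * (t * d) * (Q + 1) := by ring
      _ ≤ (Q + 1) * 2 * 2 * t' * (Q + 1) := by gcongr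

lemma main_ineq {f : ℕ → ℕ → ℕ} (hb : Bounded2Pairs f) (k : ℕ) :
    (SS k).card ≤ 2 * (TT f k).card := by
  classical
  rcases lt_or_ge k 2 with h | h
  · have w0 : wid 0 = 1 := by simp [wid, hfun]
    have s0 : (SS 0).card = 1 := by simp [SS]
    have s1 := SS_card_succ 0
    have t1 := TT_card_succ hb 0
    have t0 : 1 ≤ (TT f 0).card := by
      refine Finset.card_pos.2 ⟨Fin.elim0, Finset.mem_filter.2 ⟨mem_SS.2 fun i => i.elim0, ?_⟩⟩
      rintro x0 x1 y0 y1 ⟨i, -⟩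
      exact i.elim0
    simp [w0, s0] at s1 t1
    interval_cases k
    · omega
    · omega
  · have := main_inv hb k h
    rw [pow_succ] at this
    have hP : 0 < 2 ^ k := by positivity
    refine Nat.le_of_mul_le_mul_right ?_ hP
    nlinarith

/-- with `h = hfun`, `S` the set of finite strictly increasing sequences `σ`
with `h(k) ≤ σ(k) < h(k+1)` for all `k < |σ|`, and `T ⊆ S` the tail rainbows for a
2-bounded `f`, at every length `k` we have `|T ∩ [ℕ]^k| ≥ (1/2)·|S ∩ [ℕ]^k|`. -/
theorem statement4 (f : ℕ → ℕ → ℕ) (hbounded : Bounded2Pairs f) (k : ℕ) :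
    {σ : Fin k → ℕ | StrictMono σ ∧
        ∀ i : Fin k, hfun (i : ℕ) ≤ σ i ∧ σ i < hfun ((i : ℕ) + 1)}.ncard
      ≤ 2 * {σ : Fin k → ℕ | (StrictMono σ ∧
        ∀ i : Fin k, hfun (i : ℕ) ≤ σ i ∧ σ i < hfun ((i : ℕ) + 1)) ∧
          TailRainbowOn f (Set.range σ)}.ncard := by
  classical
  have e1 : {σ : Fin k → ℕ | StrictMono σ ∧
        ∀ i : Fin k, hfun (i : ℕ) ≤ σ i ∧ σ i < hfun ((i : ℕ) + 1)} = (SS k : Set (Fin k → ℕ)) := by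
    ext σ
    exact ⟨fun h => mem_SS.2 h.2, fun h => ⟨SS_strictMono h, mem_SS.1 h⟩⟩
  have e2 : {σ : Fin k → ℕ | (StrictMono σ ∧
        ∀ i : Fin k, hfun (i : ℕ) ≤ σ i ∧ σ i < hfun ((i : ℕ) + 1)) ∧
          TailRainbowOn f (Set.range σ)} = (TT f k : Set (Fin k → ℕ)) := by
    ext σ
    exact ⟨fun h => Finset.mem_filter.2 ⟨mem_SS.2 h.1.2, h.2⟩, fun h =>
      ⟨⟨SS_strictMono (Finset.mem_filter.1 h).1, mem_SS.1 (Finset.mem_filter.1 h).1⟩,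
        (Finset.mem_filter.1 h).2⟩⟩
  rw [e1, e2, Set.ncard_coe_finset, Set.ncard_coe_finset]
  exact main_ineq hbounded k

end RRT
end

section
/- Fix a bijection ⟨·,·⟩ from [ℕ]^2 to ℕ satisfying ⟨x₀,x₁⟩ < ⟨y₀,y₁⟩ if and only if x₁ < y₁, or x₁ = y₁ and x₀ < y₀. Let g : [ℕ]^2 → ℕ be a 2-bounded coloring such that ℕ is a tail g-rainbow, and define g̃(x₀,x₁) = min{x ≤ x₀ : g(x,x₁) = g(x₀,x₁)} and ḡ(x₀,x₁) = ⟨g̃(x₀,x₁), x₁⟩. Then ḡ is a 2-bounded normal coloring, and a set X ⊆ ℕ is a ḡ-rainbow if and only if X is a g-rainbow. Moreover, this normal coloring is unique: if h₀ and h₁ are both normal 2-bounded colorings of [ℕ]^2 with h₀ ≠ h₁, then there exists a finite set that is a rainbow for exactly one of h₀, h₁. -/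
namespace RRT

/-- The pairing function `⟨·,·⟩` is a bijection from `[ℕ]²` (pairs `x₀ < x₁`) onto ℕ. -/
def PairBij (pair : ℕ → ℕ → ℕ) : Prop :=
  (∀ n : ℕ, ∃ x₀ x₁ : ℕ, x₀ < x₁ ∧ pair x₀ x₁ = n) ∧
  (∀ x₀ x₁ y₀ y₁ : ℕ, x₀ < x₁ → y₀ < y₁ → pair x₀ x₁ = pair y₀ y₁ → x₀ = y₀ ∧ x₁ = y₁)

/-- The order property of the fixed pairing: `⟨x₀,x₁⟩ < ⟨y₀,y₁⟩` iff `x₁ < y₁`, or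
`x₁ = y₁` and `x₀ < y₀`. -/
def PairOrdered (pair : ℕ → ℕ → ℕ) : Prop :=
  ∀ x₀ x₁ y₀ y₁ : ℕ, x₀ < x₁ → y₀ < y₁ →
    (pair x₀ x₁ < pair y₀ y₁ ↔ x₁ < y₁ ∨ (x₁ = y₁ ∧ x₀ < y₀))

/-- `g̃(x₀,x₁) = min {x ≤ x₀ : g(x,x₁) = g(x₀,x₁)}` (the minimum is attained at `x₀`,
so it equals the infimum over all `x`). -/
noncomputable def gtilde (g : ℕ → ℕ → ℕ) (x₀ x₁ : ℕ) : ℕ :=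
  sInf {x : ℕ | g x x₁ = g x₀ x₁}

/-- A 2-bounded coloring `g` of `[ℕ]²` is normal (w.r.t. the fixed pairing) if
`g(x₀,x₁) = ⟨g̃(x₀,x₁), x₁⟩` for all `x₀ < x₁`. -/
def Normal (pair : ℕ → ℕ → ℕ) (g : ℕ → ℕ → ℕ) : Prop :=
  ∀ x₀ x₁ : ℕ, x₀ < x₁ → g x₀ x₁ = pair (gtilde g x₀ x₁) x₁

theorem gtilde_le (g : ℕ → ℕ → ℕ) (x₀ x₁ : ℕ) : gtilde g x₀ x₁ ≤ x₀ :=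
  Nat.sInf_le rfl

theorem gtilde_spec (g : ℕ → ℕ → ℕ) (x₀ x₁ : ℕ) : g (gtilde g x₀ x₁) x₁ = g x₀ x₁ :=
  Nat.sInf_mem (s := {x : ℕ | g x x₁ = g x₀ x₁}) ⟨x₀, rfl⟩

theorem gtilde_min (g : ℕ → ℕ → ℕ) {x x₀ x₁ : ℕ} (h : g x x₁ = g x₀ x₁) :
    gtilde g x₀ x₁ ≤ x :=
  Nat.sInf_le h

theorem gtilde_congr (g : ℕ → ℕ → ℕ) {x y z : ℕ} (h : g x z = g y z) :
    gtilde g x z = gtilde g y z := by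
  unfold gtilde
  rw [h]

theorem gtilde_inj (g : ℕ → ℕ → ℕ) {x y z : ℕ} (h : gtilde g x z = gtilde g y z) :
    g x z = g y z := by
  rw [← gtilde_spec g x z, h, gtilde_spec g y z]

theorem bar_iff (pair : ℕ → ℕ → ℕ) (hbij : PairBij pair) (g : ℕ → ℕ → ℕ)
    (htail : TailRainbowOn g Set.univ) {x₀ x₁ y₀ y₁ : ℕ} (hx : x₀ < x₁) (hy : y₀ < y₁) :
    pair (gtilde g x₀ x₁) x₁ = pair (gtilde g y₀ y₁) y₁ ↔ g x₀ x₁ = g y₀ y₁ := by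
  constructor
  · intro h
    obtain ⟨h1, h2⟩ := hbij.2 _ _ _ _ ((gtilde_le g x₀ x₁).trans_lt hx)
      ((gtilde_le g y₀ y₁).trans_lt hy) h
    subst h2
    exact gtilde_inj g h1
  · intro h
    by_cases h2 : x₁ = y₁
    · subst h2
      rw [gtilde_congr g h]
    · exact absurd h (htail _ _ _ _ trivial trivial trivial trivial hx hy h2)

theorem normal_tail (pair : ℕ → ℕ → ℕ) (hbij : PairBij pair) (h : ℕ → ℕ → ℕ)
    (hn : Normal pair h) {x₀ x₁ y₀ y₁ : ℕ} (hx : x₀ < x₁) (hy : y₀ < y₁)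
    (e : h x₀ x₁ = h y₀ y₁) : x₁ = y₁ := by
  rw [hn _ _ hx, hn _ _ hy] at e
  exact (hbij.2 _ _ _ _ ((gtilde_le h x₀ x₁).trans_lt hx)
      ((gtilde_le h y₀ y₁).trans_lt hy) e).2

theorem distinguish (pair : ℕ → ℕ → ℕ) (hbij : PairBij pair) (h₀ h₁ : ℕ → ℕ → ℕ)
    (hn : Normal pair h₁) {x₀ x₁ : ℕ} (hx : x₀ < x₁)
    (hlt : gtilde h₀ x₀ x₁ < gtilde h₁ x₀ x₁) :
    ∃ F : Finset ℕ, ¬ RainbowOn h₀ ↑F ∧ RainbowOn h₁ ↑F := by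
  have hax : gtilde h₀ x₀ x₁ < x₀ := hlt.trans_le (gtilde_le _ _ _)
  have hspec := gtilde_spec h₀ x₀ x₁
  generalize gtilde h₀ x₀ x₁ = a at *
  have hne : h₁ a x₁ ≠ h₁ x₀ x₁ := fun e => absurd (gtilde_min h₁ e) (by omega)
  refine ⟨{a, x₀, x₁}, ?_, ?_⟩
  · intro hr
    have := (hr a x₁ x₀ x₁ (by simp) (by simp) (by simp) (by simp) (by omega) hx hspec).1
    omega
  · intro u₀ u₁ v₀ v₁ hu₀ hu₁ hv₀ hv₁ hu hv e
    have h2 := normal_tail pair hbij h₁ hn hu hv e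
    subst h2
    refine ⟨?_, rfl⟩
    simp only [Finset.coe_insert, Finset.coe_singleton, Set.mem_insert_iff,
      Set.mem_singleton_iff] at hu₀ hu₁ hv₀
    rcases hu₁ with rfl | rfl | rfl
    · omega
    · omega
    · rcases hu₀ with rfl | rfl | rfl <;> rcases hv₀ with rfl | rfl | rfl <;>
        first
          | rfl
          | omega

/-- for a 2-bounded `g` with ℕ a tail `g`-rainbow, the coloring
`ḡ(x₀,x₁) = ⟨g̃(x₀,x₁),x₁⟩` is a 2-bounded normal coloring with exactly the same rainbows
as `g`; moreover distinct normal 2-bounded colorings are distinguished by some finite set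
which is a rainbow for exactly one of them. -/
theorem statement6 (pair : ℕ → ℕ → ℕ) (hbij : PairBij pair) (hord : PairOrdered pair)
    (g : ℕ → ℕ → ℕ) (hbounded : Bounded2Pairs g) (htail : TailRainbowOn g Set.univ) :
    (Bounded2Pairs fun x₀ x₁ => pair (gtilde g x₀ x₁) x₁) ∧
    (Normal pair fun x₀ x₁ => pair (gtilde g x₀ x₁) x₁) ∧
    (∀ X : Set ℕ, RainbowOn (fun x₀ x₁ => pair (gtilde g x₀ x₁) x₁) X ↔ RainbowOn g X) ∧
    (∀ h₀ h₁ : ℕ → ℕ → ℕ, Bounded2Pairs h₀ → Bounded2Pairs h₁ →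
      Normal pair h₀ → Normal pair h₁ → (∃ x₀ x₁ : ℕ, x₀ < x₁ ∧ h₀ x₀ x₁ ≠ h₁ x₀ x₁) →
      ∃ F : Finset ℕ, (RainbowOn h₀ ↑F ∧ ¬ RainbowOn h₁ ↑F) ∨
        (¬ RainbowOn h₀ ↑F ∧ RainbowOn h₁ ↑F)) := by
  have key := fun {x₀ x₁ y₀ y₁ : ℕ} => bar_iff pair hbij g htail (x₀ := x₀) (x₁ := x₁)
    (y₀ := y₀) (y₁ := y₁)
  refine ⟨?_, ?_, ?_, ?_⟩
  · intro c
    rcases Set.eq_empty_or_nonempty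
      {p : ℕ × ℕ | p.1 < p.2 ∧ pair (gtilde g p.1 p.2) p.2 = c} with h | ⟨p, hp, hc⟩
    · simp only [h, Set.encard_empty, zero_le]
    · refine (Set.encard_le_encard ?_).trans (hbounded (g p.1 p.2))
      rintro q ⟨hq, hqc⟩
      exact ⟨hq, (key hq hp).1 (hqc.trans hc.symm)⟩
  · intro x₀ x₁ hx
    have : gtilde (fun x₀ x₁ => pair (gtilde g x₀ x₁) x₁) x₀ x₁ = gtilde g x₀ x₁ := by
      apply le_antisymm
      · apply gtilde_min
        exact (key ((gtilde_le g x₀ x₁).trans_lt hx) hx).2 (gtilde_spec g x₀ x₁)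
      · apply gtilde_min
        exact (key ((gtilde_le _ x₀ x₁).trans_lt hx) hx).1
          (gtilde_spec (fun x₀ x₁ => pair (gtilde g x₀ x₁) x₁) x₀ x₁)
    rw [this]
  · intro X
    constructor
    · intro h x₀ x₁ y₀ y₁ a b c d hx hy e
      exact h x₀ x₁ y₀ y₁ a b c d hx hy ((key hx hy).2 e)
    · intro h x₀ x₁ y₀ y₁ a b c d hx hy e
      exact h x₀ x₁ y₀ y₁ a b c d hx hy ((key hx hy).1 e)
  · rintro h₀ h₁ - - n₀ n₁ ⟨x₀, x₁, hx, hne⟩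
    rw [n₀ _ _ hx, n₁ _ _ hx] at hne
    rcases lt_trichotomy (gtilde h₀ x₀ x₁) (gtilde h₁ x₀ x₁) with h | h | h
    · obtain ⟨F, hF⟩ := distinguish pair hbij h₀ h₁ n₁ hx h
      exact ⟨F, Or.inr hF⟩
    · exact absurd (by rw [h]) hne
    · obtain ⟨F, hF⟩ := distinguish pair hbij h₁ h₀ n₀ hx h
      exact ⟨F, Or.inl hF.symm⟩

end RRT
end
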